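/- arXiv:1410.4819 — 2 statements merged into one kernel-verified Lean document; each statement's English description precedes it below -/
import Mathlib

section
/- Let 1 ≤ k ≤ m and let ν be any permutation of {1,…,k}. Then the m-th iterate of W_ν is the identity on S_{k,m}: for every x ∈ S_{k,m}, W_ν^m(x) = x. -/
-- The set `S_{k,m}` of strictly increasing `k`-tuples with entries in `{1, …, m}`.
def Smem (k m : ℕ) (x : Fin k → ℕ) : Prop :=
  StrictMono x ∧ ∀ i, 1 ≤ x i ∧ x i ≤ m

-- Extension of a tuple by the boundary conventions `x_0 = 0`, `x_{k+1} = m+1`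
-- (1-based indexing: `extS k m x j` is `x_j`).
def extS (k m : ℕ) (x : Fin k → ℕ) (j : ℕ) : ℕ :=
  if h : 1 ≤ j ∧ j ≤ k then x ⟨j - 1, by omega⟩ else if j = 0 then 0 else m + 1

-- Winching at (0-based) index `i`:  `y_i = x_i + 1` if `x_i + 1 < x_{i+1}`, else `y_i = x_{i-1} + 1`.
def winch (k m : ℕ) (i : Fin k) (x : Fin k → ℕ) : Fin k → ℕ := fun j =>
  if j = i then
    (if x i + 1 < extS k m x (i.val + 2) then x i + 1 else extS k m x i.val + 1)
  else x j

-- `W_ν = W_{ν(k)} ∘ … ∘ W_{ν(1)}` (so `W_{ν(1)}` is applied first).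
def winchPerm (k m : ℕ) (ν : Equiv.Perm (Fin k)) (x : Fin k → ℕ) : Fin k → ℕ :=
  List.foldl (fun y t => winch k m (ν t) y) x (List.ofFn (fun t : Fin k => t))

/-- The boundary conventions and strict monotonicity of a tuple, in terms of its extension. -/
def ExtStrict (k m : ℕ) (x : Fin k → ℕ) : Prop :=
  ∀ j ≤ k, extS k m x j < extS k m x (j + 1)

theorem extS_zero (k m : ℕ) (x : Fin k → ℕ) : extS k m x 0 = 0 := by
  simp [extS]

theorem extS_of_lt (k m : ℕ) (x : Fin k → ℕ) {j : ℕ} (hj : k < j) : extS k m x j = m + 1 := by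
  have h : ¬ (1 ≤ j ∧ j ≤ k) := by omega
  have h' : j ≠ 0 := by omega
  simp [extS, h, h']

theorem extS_succ (k m : ℕ) (x : Fin k → ℕ) (i : Fin k) : extS k m x (i.val + 1) = x i := by
  simp [extS, i.isLt]

theorem eq_of_extS_eq {k m : ℕ} {x y : Fin k → ℕ}
    (h : ∀ j, extS k m x j = extS k m y j) : x = y := by
  funext i
  rw [← extS_succ k m x i, ← extS_succ k m y i, h]

theorem Smem.extStrict {k m : ℕ} {x : Fin k → ℕ} (hx : Smem k m x) : ExtStrict k m x := by
  intro j hj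
  rcases Nat.eq_zero_or_pos j with rfl | hj0
  · rw [extS_zero]
    rcases Nat.eq_zero_or_pos k with rfl | hk
    · rw [extS_of_lt 0 m x (by omega)]; omega
    · have := extS_succ k m x ⟨0, hk⟩
      have := (hx.2 ⟨0, hk⟩).1
      simp_all
      omega
  · obtain ⟨j, rfl⟩ : ∃ l, j = l + 1 := ⟨j - 1, by omega⟩
    have h1 := extS_succ k m x ⟨j, by omega⟩
    simp only at h1
    rw [h1]
    rcases Nat.lt_or_ge (j + 1) k with hlt | hge
    · have h2 := extS_succ k m x ⟨j + 1, hlt⟩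
      simp only at h2
      rw [h2]
      exact hx.1 (by simp [Fin.lt_def])
    · rw [extS_of_lt k m x (by omega)]
      have := (hx.2 ⟨j, by omega⟩).2
      omega

theorem extS_winch (k m : ℕ) (i : Fin k) (x : Fin k → ℕ) (j : ℕ) :
    extS k m (winch k m i x) j =
      if j = i.val + 1 then
        (if extS k m x (i.val + 1) + 1 < extS k m x (i.val + 2) then extS k m x (i.val + 1) + 1
          else extS k m x i.val + 1)
      else extS k m x j := by
  split_ifs with h1 h2
  · subst h1
    rw [extS_succ] at h2 ⊢
    rw [extS_succ]
    simp [winch, h2]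
  · subst h1
    rw [extS_succ] at h2 ⊢
    simp [winch, h2]
  · by_cases hj : 1 ≤ j ∧ j ≤ k
    · have : (⟨j - 1, by omega⟩ : Fin k) ≠ i := by
        intro h
        have := congrArg Fin.val h
        simp only at this
        omega
      simp [extS, hj, winch, this]
    · simp [extS, hj]

theorem ExtStrict.winch {k m : ℕ} {x : Fin k → ℕ} (hx : ExtStrict k m x) (i : Fin k) :
    ExtStrict k m (winch k m i x) := by
  intro j hj
  have h0 := hx j hj
  have h1 := hx i.val i.isLt.le
  have h2 := hx (i.val + 1) i.isLt
  rw [extS_winch, extS_winch]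
  by_cases ha : j = i.val + 1
  · subst ha
    simp only [add_assoc, Nat.reduceAdd] at *
    split_ifs <;> omega
  · by_cases hb : j = i.val
    · subst hb
      simp only [add_assoc, Nat.reduceAdd] at *
      split_ifs <;> omega
    · rw [if_neg ha, if_neg (by omega)]
      exact h0

theorem winch_injOn {k m : ℕ} (i : Fin k) {x y : Fin k → ℕ} (hx : ExtStrict k m x)
    (hy : ExtStrict k m y) (h : winch k m i x = winch k m i y) : x = y := by
  have key : ∀ j, extS k m (winch k m i x) j = extS k m (winch k m i y) j := by
    intro j; rw [h]
  simp only [extS_winch] at key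
  have hne : ∀ j, j ≠ i.val + 1 → extS k m x j = extS k m y j := by
    intro j hj
    simpa [hj] using key j
  apply eq_of_extS_eq (m := m)
  intro j
  by_cases hj : j = i.val + 1
  · subst hj
    have e := key (i.val + 1)
    have e0 := hne i.val (by omega)
    have e2 := hne (i.val + 2) (by omega)
    have x1 := hx i.val i.isLt.le
    have x2 := hx (i.val + 1) i.isLt
    have y1 := hy i.val i.isLt.le
    have y2 := hy (i.val + 1) i.isLt
    simp only [add_assoc, Nat.reduceAdd, if_true] at *
    split_ifs at e <;> omega
  · exact hne j hj

/-- The composition of the first `s` winches of `winchPerm k m ν`. -/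
def winchPrefix (k m : ℕ) (ν : Equiv.Perm (Fin k)) (x : Fin k → ℕ) : ℕ → Fin k → ℕ
  | 0 => x
  | s + 1 => if h : s < k then winch k m (ν ⟨s, h⟩) (winchPrefix k m ν x s)
      else winchPrefix k m ν x s

theorem winchPrefix_eq_foldl (k m : ℕ) (ν : Equiv.Perm (Fin k)) (x : Fin k → ℕ) (s : ℕ)
    (hs : s ≤ k) :
    winchPrefix k m ν x s =
      List.foldl (fun y t => winch k m (ν t) y) x ((List.ofFn (fun t : Fin k => t)).take s) := by
  induction s with
  | zero => simp [winchPrefix]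
  | succ s ih =>
    have hs' : s < k := hs
    rw [List.take_add_one, List.foldl_append, ← ih hs'.le]
    simp [winchPrefix, hs']

theorem winchPrefix_self (k m : ℕ) (ν : Equiv.Perm (Fin k)) (x : Fin k → ℕ) :
    winchPrefix k m ν x k = winchPerm k m ν x := by
  rw [winchPrefix_eq_foldl k m ν x k le_rfl, List.take_of_length_le (by simp), winchPerm]

theorem ExtStrict.winchPrefix {k m : ℕ} {x : Fin k → ℕ} (hx : ExtStrict k m x)
    (ν : Equiv.Perm (Fin k)) (s : ℕ) : ExtStrict k m (winchPrefix k m ν x s) := by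
  induction s with
  | zero => exact hx
  | succ s ih =>
    rw [_root_.winchPrefix]
    split_ifs
    · exact ih.winch _
    · exact ih

theorem ExtStrict.winchPerm {k m : ℕ} {x : Fin k → ℕ} (hx : ExtStrict k m x)
    (ν : Equiv.Perm (Fin k)) : ExtStrict k m (winchPerm k m ν x) := by
  rw [← winchPrefix_self]
  exact hx.winchPrefix ν k

theorem winchPrefix_injOn {k m : ℕ} (ν : Equiv.Perm (Fin k)) (s : ℕ) {x y : Fin k → ℕ}
    (hx : ExtStrict k m x) (hy : ExtStrict k m y)
    (h : winchPrefix k m ν x s = winchPrefix k m ν y s) : x = y := by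
  induction s with
  | zero => exact h
  | succ s ih =>
    apply ih
    rw [winchPrefix, winchPrefix] at h
    split_ifs at h
    · exact winch_injOn _ (hx.winchPrefix ν s) (hy.winchPrefix ν s) h
    · exact h

theorem ExtStrict.winchPerm_iterate {k m : ℕ} {x : Fin k → ℕ} (hx : ExtStrict k m x)
    (ν : Equiv.Perm (Fin k)) (n : ℕ) : ExtStrict k m ((_root_.winchPerm k m ν)^[n] x) := by
  induction n with
  | zero => exact hx
  | succ n ih =>
    rw [Function.iterate_succ_apply']
    exact ih.winchPerm ν

theorem winchPerm_iterate_injOn {k m : ℕ} (ν : Equiv.Perm (Fin k)) (n : ℕ) {x y : Fin k → ℕ}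
    (hx : ExtStrict k m x) (hy : ExtStrict k m y)
    (h : (winchPerm k m ν)^[n] x = (winchPerm k m ν)^[n] y) : x = y := by
  induction n with
  | zero => exact h
  | succ n ih =>
    apply ih
    rw [Function.iterate_succ_apply', Function.iterate_succ_apply', ← winchPrefix_self,
      ← winchPrefix_self] at h
    exact winchPrefix_injOn ν k (hx.winchPerm_iterate ν n) (hy.winchPerm_iterate ν n) h

/-- The (0-based) time at which the 1-based index `j` is winched by `winchPerm k m ν`. -/
def winchTime (k : ℕ) (ν : Equiv.Perm (Fin k)) (j : ℕ) : ℕ :=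
  if h : 1 ≤ j ∧ j ≤ k then (ν.symm ⟨j - 1, by omega⟩).val else 0

theorem winchTime_succ {k : ℕ} (ν : Equiv.Perm (Fin k)) (i : Fin k) :
    winchTime k ν (i.val + 1) = (ν.symm i).val := by
  simp [winchTime, i.isLt]

theorem winchTime_ne_succ {k : ℕ} (ν : Equiv.Perm (Fin k)) {j : ℕ} (hj : 1 ≤ j) (hjk : j < k) :
    winchTime k ν j ≠ winchTime k ν (j + 1) := by
  obtain ⟨j, rfl⟩ : ∃ l, j = l + 1 := ⟨j - 1, by omega⟩
  have h1 := winchTime_succ ν ⟨j, by omega⟩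
  have h2 := winchTime_succ ν ⟨j + 1, hjk⟩
  simp only at h1 h2
  rw [h1, h2]
  intro h
  have := ν.symm.injective (Fin.ext h)
  simp at this

theorem winchPrefix_apply_of_le {k m : ℕ} (ν : Equiv.Perm (Fin k)) (x : Fin k → ℕ) (i : Fin k)
    (s : ℕ) (hs : s ≤ (ν.symm i).val) : winchPrefix k m ν x s i = x i := by
  induction s with
  | zero => rfl
  | succ s ih =>
    have hsk : s < k := by omega
    have hne : i ≠ ν ⟨s, hsk⟩ := by
      rintro rfl
      simp at hs
    simp [winchPrefix, hsk, winch, hne, ih (by omega)]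

theorem winchPrefix_apply_of_lt {k m : ℕ} (ν : Equiv.Perm (Fin k)) (x : Fin k → ℕ) (i : Fin k)
    (s : ℕ) (hs : (ν.symm i).val + 1 ≤ s) :
    winchPrefix k m ν x s i = winchPrefix k m ν x ((ν.symm i).val + 1) i := by
  induction s, hs using Nat.le_induction with
  | base => rfl
  | succ s hs ih =>
    rw [← ih, winchPrefix]
    split_ifs with hsk
    · have hne : i ≠ ν ⟨s, hsk⟩ := by
        rintro rfl
        simp at hs
      simp [winch, hne]
    · rfl

theorem extS_winchPrefix {k m : ℕ} (ν : Equiv.Perm (Fin k)) (x : Fin k → ℕ) (s j : ℕ) :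
    extS k m (winchPrefix k m ν x s) j =
      if winchTime k ν j < s then extS k m (winchPerm k m ν x) j else extS k m x j := by
  by_cases hj : 1 ≤ j ∧ j ≤ k
  · obtain ⟨j, rfl⟩ : ∃ l, j = l + 1 := ⟨j - 1, by omega⟩
    have h1 := winchTime_succ ν ⟨j, by omega⟩
    have h2 := fun y => extS_succ k m y ⟨j, by omega⟩
    simp only at h1 h2
    rw [h1, h2, h2, h2]
    split_ifs with hs
    · rw [← winchPrefix_self, winchPrefix_apply_of_lt ν x _ s hs,
        winchPrefix_apply_of_lt ν x _ k (ν.symm _).isLt]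
    · exact winchPrefix_apply_of_le ν x _ s (by omega)
  · simp [extS, hj]

theorem extS_winchPerm {k m : ℕ} (ν : Equiv.Perm (Fin k)) (x : Fin k → ℕ) {j : ℕ} (hj : j < k) :
    extS k m (winchPerm k m ν x) (j + 1) =
      if extS k m x (j + 1) + 1 <
          (if winchTime k ν (j + 2) < winchTime k ν (j + 1) then
            extS k m (winchPerm k m ν x) (j + 2) else extS k m x (j + 2))
      then extS k m x (j + 1) + 1
      else (if winchTime k ν j < winchTime k ν (j + 1) then
            extS k m (winchPerm k m ν x) j else extS k m x j) + 1 := by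
  have h1 := winchTime_succ ν ⟨j, hj⟩
  simp only at h1
  have hlt : winchTime k ν (j + 1) < k := by rw [h1]; exact (ν.symm _).isLt
  have hν : ν ⟨winchTime k ν (j + 1), hlt⟩ = ⟨j, hj⟩ := by
    rw [← Equiv.eq_symm_apply]
    exact Fin.ext h1
  have h2 := extS_winchPrefix (m := m) ν x (winchTime k ν (j + 1) + 1) (j + 1)
  rw [if_pos (Nat.lt_succ_self _)] at h2
  rw [← h2, winchPrefix, dif_pos hlt, hν, extS_winch]
  simp only [if_true, extS_winchPrefix, lt_irrefl, if_false]

theorem ExtStrict.extS_winchPerm_lt {k m : ℕ} {x : Fin k → ℕ} (hx : ExtStrict k m x)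
    (ν : Equiv.Perm (Fin k)) {j : ℕ} (hj : j ≤ k)
    (h : winchTime k ν j < winchTime k ν (j + 1)) :
    extS k m (_root_.winchPerm k m ν x) j < extS k m x (j + 1) := by
  have := hx.winchPrefix ν (winchTime k ν j + 1) j hj
  rwa [extS_winchPrefix, extS_winchPrefix, if_pos (Nat.lt_succ_self _),
    if_neg (by omega)] at this

/-- A space-time array obeying the recursion of winching in the order `k, k - 1, …, 1` has its
rows cyclically rotated modulo `m`, hence is periodic in time with period `m`. -/
theorem winch_array_periodic {k m : ℕ} (b : ℕ → ℕ → ℕ) (h0 : ∀ t, b t 0 = 0)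
    (hlast : ∀ t, b t (k + 1) = m + 1) (hmono : ∀ t, ∀ j ≤ k, b t j < b t (j + 1))
    (hrec : ∀ t, ∀ j < k, b (t + 1) (j + 1) =
      if b t (j + 1) + 1 < b (t + 1) (j + 2) then b t (j + 1) + 1 else b t j + 1)
    (t : ℕ) {j : ℕ} (hj : j < k) : b (t + m) (j + 1) = b t (j + 1) := by
  have hbd : ∀ t, b t k ≤ m := fun t => by
    have := hmono t k le_rfl
    rw [hlast] at this
    omega
  have rot_lt : ∀ t, b t k < m → ∀ d j, j + 1 + d = k → b (t + 1) (j + 1) = b t (j + 1) + 1 := by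
    intro t ht d
    induction d with
    | zero =>
      intro j hj
      rw [hrec t j (by omega), if_pos]
      have : j + 1 = k := hj
      rw [show j + 2 = k + 1 by omega, hlast, this]
      omega
    | succ d ih =>
      intro j hj
      rw [hrec t j (by omega), if_pos]
      rw [ih (j + 1) (by omega)]
      have := hmono t (j + 1) (by omega)
      omega
  have rot_eq : ∀ t, b t k = m → ∀ d j, j + 1 + d = k → b (t + 1) (j + 1) = b t j + 1 := by
    intro t ht d
    induction d with
    | zero =>
      intro j hj
      rw [hrec t j (by omega), if_neg]
      have : j + 1 = k := hj
      rw [show j + 2 = k + 1 by omega, hlast, this]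
      omega
    | succ d ih =>
      intro j hj
      rw [hrec t j (by omega), if_neg]
      rw [ih (j + 1) (by omega)]
      omega
  have hsm : ∀ t, StrictMono (fun i : Fin k => b t (i.val + 1)) := by
    intro t
    have : ∀ p q, p < q → q ≤ k → b t p < b t q := by
      intro p q hpq
      induction q, hpq using Nat.le_induction with
      | base => intro h; exact hmono t p (by omega)
      | succ q hq ih => intro h; exact (ih (by omega)).trans (hmono t q (by omega))
    intro p q hpq
    exact this _ _ (by simpa using hpq) q.isLt
  let M : ℕ → ℕ → Prop := fun t v => ∃ j < k, b t (j + 1) = v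
  have hlt_last : ∀ t j, j + 1 < k → b t (j + 1) < b t k := by
    intro t j hj
    have := @hsm t ⟨j, by omega⟩ ⟨k - 1, by omega⟩ (by simp [Fin.lt_def]; omega)
    simpa [show k - 1 + 1 = k by omega] using this
  have step : ∀ t v, v < m → M t v → M (t + 1) (v + 1) := by
    rintro t v hv ⟨j, hj, rfl⟩
    rcases (hbd t).lt_or_eq with h | h
    · exact ⟨j, hj, rot_lt t h (k - (j + 1)) j (by omega)⟩
    · have hjk : j + 1 < k := by
        by_contra hc
        rw [show j + 1 = k by omega] at hv
        omega
      exact ⟨j + 1, hjk, rot_eq t h (k - (j + 2)) (j + 1) (by omega)⟩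
  have wrap : ∀ t, M t m → M (t + 1) 1 := by
    rintro t ⟨j, hj, hm⟩
    have hk : b t k = m := by
      rcases Nat.lt_or_ge (j + 1) k with h | h
      · have := hlt_last t j h
        have := hbd t
        omega
      · rwa [show j + 1 = k by omega] at hm
    exact ⟨0, by omega, by rw [rot_eq t hk (k - 1) 0 (by omega), h0]⟩
  have steps : ∀ s t v, v + s ≤ m → M t v → M (t + s) (v + s) := by
    intro s
    induction s with
    | zero => intro t v _ h; exact h
    | succ s ih =>
      intro t v hv h
      exact step (t + s) (v + s) (by omega) (ih t v (by omega) h)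
  have cycle : ∀ t v, 1 ≤ v → v ≤ m → M t v → M (t + m) v := by
    intro t v hv hvm h
    have a1 := steps (m - v) t v (by omega) h
    rw [show v + (m - v) = m by omega] at a1
    have a2 := steps (v - 1) _ 1 (by omega) (wrap _ a1)
    rwa [show t + (m - v) + 1 + (v - 1) = t + m by omega, show 1 + (v - 1) = v by omega] at a2
  let f : ℕ → Fin k → ℕ := fun t i => b t (i.val + 1)
  have hsub : Finset.univ.image (f t) ⊆ Finset.univ.image (f (t + m)) := by
    intro v hv
    simp only [Finset.mem_image, Finset.mem_univ, true_and] at hv ⊢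
    obtain ⟨i, rfl⟩ := hv
    have hpos : 1 ≤ b t (i.val + 1) := by
      have := hmono t i.val i.isLt.le
      omega
    have hle : b t (i.val + 1) ≤ m := by
      rcases Nat.lt_or_ge (i.val + 1) k with h | h
      · exact (hlt_last t i h).le.trans (hbd t)
      · rw [show i.val + 1 = k by omega]
        exact hbd t
    obtain ⟨l, hl, e⟩ := cycle t _ hpos hle ⟨i.val, i.isLt, rfl⟩
    exact ⟨⟨l, hl⟩, e⟩
  have heq := Finset.eq_of_subset_of_card_le hsub (by
    rw [Finset.card_image_of_injective _ (hsm t).injective,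
      Finset.card_image_of_injective _ (hsm (t + m)).injective])
  have hrange : Set.range (f (t + m)) = Set.range (f t) := by
    have := congrArg (fun s : Finset ℕ => (s : Set ℕ)) heq
    simpa using this.symm
  exact congrFun ((StrictMono.range_inj (hsm (t + m)) (hsm t)).1 hrange) ⟨j, hj⟩

/-- The number of indices `l` with `j ≤ l ≤ k` that are winched before their successor. -/
def winchDelay (k : ℕ) (ν : Equiv.Perm (Fin k)) (j : ℕ) : ℕ :=
  ((Finset.Ico j (k + 1)).filter fun l => winchTime k ν l < winchTime k ν (l + 1)).card

theorem winchDelay_eq {k : ℕ} (ν : Equiv.Perm (Fin k)) {j : ℕ} (hj : j ≤ k) :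
    winchDelay k ν j = winchDelay k ν (j + 1) +
      if winchTime k ν j < winchTime k ν (j + 1) then 1 else 0 := by
  unfold winchDelay
  rw [← Finset.insert_Ico_add_one_left_eq_Ico (show j < k + 1 by omega), Finset.filter_insert]
  split_ifs
  · rw [Finset.card_insert_of_notMem (by simp)]
  · rfl

theorem extS_winchPerm_iterate_periodic {k m : ℕ} (ν : Equiv.Perm (Fin k)) {x : Fin k → ℕ}
    (hx : ExtStrict k m x) (t : ℕ) {j : ℕ} (hj : j < k) :
    extS k m ((winchPerm k m ν)^[t + m + winchDelay k ν (j + 1)] x) (j + 1) =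
      extS k m ((winchPerm k m ν)^[t + winchDelay k ν (j + 1)] x) (j + 1) := by
  refine winch_array_periodic (k := k)
    (fun t j => extS k m ((winchPerm k m ν)^[t + winchDelay k ν j] x) j)
    (fun t => extS_zero _ _ _) (fun t => extS_of_lt _ _ _ (by omega)) ?_ ?_ t hj
  · intro t j hj
    rw [winchDelay_eq ν hj]
    split_ifs with h
    · rw [← add_assoc, Function.iterate_succ_apply']
      exact (hx.winchPerm_iterate ν _).extS_winchPerm_lt ν hj h
    · exact hx.winchPerm_iterate ν _ j hj
  · intro t j hj
    have hR : extS k m ((winchPerm k m ν)^[t + 1 + winchDelay k ν (j + 2)] x) (j + 2) =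
        if winchTime k ν (j + 2) < winchTime k ν (j + 1) then
          extS k m ((winchPerm k m ν)^[t + winchDelay k ν (j + 1) + 1] x) (j + 2)
        else extS k m ((winchPerm k m ν)^[t + winchDelay k ν (j + 1)] x) (j + 2) := by
      rcases Nat.lt_or_ge (j + 1) k with h | h
      · have hne := winchTime_ne_succ ν (show 1 ≤ j + 1 by omega) h
        have hd := winchDelay_eq ν h.le
        simp only [add_assoc, Nat.reduceAdd] at hne hd
        split_ifs with hlt
        · rw [if_neg (by omega)] at hd
          congr 2
          omega
        · rw [if_pos (by omega)] at hd
          congr 2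
          omega
      · simp only [extS_of_lt k m _ (show k < j + 2 by omega), ite_self]
    have hL : extS k m ((winchPerm k m ν)^[t + winchDelay k ν j] x) j =
        if winchTime k ν j < winchTime k ν (j + 1) then
          extS k m ((winchPerm k m ν)^[t + winchDelay k ν (j + 1) + 1] x) j
        else extS k m ((winchPerm k m ν)^[t + winchDelay k ν (j + 1)] x) j := by
      rw [winchDelay_eq ν hj.le]
      split_ifs <;> rfl
    rw [hR, hL, show t + 1 + winchDelay k ν (j + 1) = t + winchDelay k ν (j + 1) + 1 by omega,
      Function.iterate_succ_apply']
    exact extS_winchPerm ν _ hj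

/-- the `m`-th iterate of `W_ν` is the identity on `S_{k,m}`. -/
theorem stmt_5 (k m : ℕ) (hk : 1 ≤ k) (hkm : k ≤ m) (ν : Equiv.Perm (Fin k))
    (x : Fin k → ℕ) (hx : Smem k m x) :
    (winchPerm k m ν)^[m] x = x := by
  have hs := hx.extStrict
  have hle : ∀ j, winchDelay k ν j ≤ k + 1 := fun j =>
    (Finset.card_filter_le _ _).trans (by simp)
  refine winchPerm_iterate_injOn ν (k + 1) (hs.winchPerm_iterate ν m) hs ?_
  rw [← Function.iterate_add_apply]
  funext i
  have h := extS_winchPerm_iterate_periodic ν hs (k + 1 - winchDelay k ν (i.val + 1)) i.isLt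
  have := hle (i.val + 1)
  rw [extS_succ, extS_succ,
    show k + 1 - winchDelay k ν (i.val + 1) + m + winchDelay k ν (i.val + 1) = k + 1 + m by omega,
    show k + 1 - winchDelay k ν (i.val + 1) + winchDelay k ν (i.val + 1) = k + 1 by omega] at h
  exact h
end

section
/- Let a, b ≥ 1. For any two permutations ν and ω of [a], the multiset of orbit sizes of the comotion T_ν acting on J(Q_{a,b}) equals the multiset of orbit sizes of T_ω acting on J(Q_{a,b}); that is, the orbit structure of comotion on J(Q_{a,b}) is independent of the choice of permutation. -/
/-- An order ideal (down-closed subset) of a poset, as a `Finset`. -/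
def IsIdeal {α : Type*} [PartialOrder α] (I : Finset α) : Prop :=
  ∀ x ∈ I, ∀ y, y ≤ x → y ∈ I

-- The toggle `σ_x`: add `x` if the result is still an order ideal, remove `x` if the
-- result is still an order ideal, otherwise do nothing.
open Classical in
noncomputable def toggle {α : Type*} [PartialOrder α] (x : α) (I : Finset α) : Finset α :=
  if x ∉ I ∧ IsIdeal (insert x I) then insert x I
  else if x ∈ I ∧ IsIdeal (I.erase x) then I.erase x
  else I

-- The poset `Q_{a,b}` is represented as `Fin a × Fin b` with the componentwise
-- (product) order; the 0-based pair `(i, j)` represents the 1-based `(i+1, j+1)`.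

-- `colCard I i = |C_{i+1}(I)|`: the number of elements of `I` in (0-based) column `i`.
def colCard {a b : ℕ} (I : Finset (Fin a × Fin b)) (i : Fin a) : ℕ :=
  (I.filter (fun p => p.1 = i)).card

-- The column toggle `σ_{C_i}`, toggling the elements of column `i` from the topmost
-- down to the bottommost.
noncomputable def colToggle {a b : ℕ} (i : Fin a) (I : Finset (Fin a × Fin b)) :
    Finset (Fin a × Fin b) :=
  List.foldr (fun (j : Fin b) K => toggle (i, j) K) I (List.ofFn (fun j : Fin b => j))

-- Comotion `T_ν = σ_{C_{ν(a)}} ∘ … ∘ σ_{C_{ν(1)}}` (so `σ_{C_{ν(1)}}` is applied first).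
noncomputable def comotion {a b : ℕ} (ν : Equiv.Perm (Fin a)) (I : Finset (Fin a × Fin b)) :
    Finset (Fin a × Fin b) :=
  List.foldl (fun K t => colToggle (ν t) K) I (List.ofFn (fun t : Fin a => t))

section Conjugacy

variable {G : Type*} [Group G]

/-- If the only noncommuting pairs among `g 0, …, g (n - 1)` are consecutive, then all the products
of these elements, one for each ordering, are conjugate. -/
theorem isConj_prod_map_range (n : ℕ) (g : ℕ → G) (l : List ℕ)
    (hg : ∀ i j, i + 2 ≤ j → j < n → Commute (g i) (g j)) (hl : l.Perm (List.range n)) :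
    IsConj (l.map g).prod ((List.range n).map g).prod := by
  induction n generalizing g l with
  | zero =>
    rw [List.range_zero, List.perm_nil] at hl
    subst hl
    exact IsConj.refl _
  | succ n ih =>
    rcases n with _ | m
    · rw [List.range_one, List.perm_singleton] at hl
      subst hl
      exact IsConj.refl _
    have comm_prod : ∀ k : List ℕ, (∀ i ∈ k, i < m) → Commute (k.map g).prod (g (m + 1)) := by
      intro k hk
      refine (Commute.list_prod_right _ _ fun x hx => ?_).symm
      obtain ⟨i, hi, rfl⟩ := List.mem_map.1 hx
      exact (hg i (m + 1) (by have := hk i hi; omega) (by omega)).symm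
    obtain ⟨l₁, l₂, rfl⟩ := List.append_of_mem (hl.mem_iff.2 (List.self_mem_range_succ (n := m + 1)))
    have hl' : (l₁ ++ l₂).Perm (List.range (m + 1)) := by
      have h₁ := List.perm_middle.symm.trans hl
      rw [List.range_succ] at h₁
      exact (List.perm_cons _).1 (h₁.trans (List.perm_append_singleton _ _))
    have hnd : (l₁ ++ l₂).Nodup := hl'.nodup_iff.2 List.nodup_range
    have hlt : ∀ i ∈ l₁ ++ l₂, i < m + 1 := fun i hi => List.mem_range.1 (hl'.mem_iff.1 hi)
    have to_end : IsConj ((l₁ ++ (m + 1) :: l₂).map g).prod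
        (((l₁ ++ l₂).map g).prod * g (m + 1)) := by
      simp only [List.map_append, List.map_cons, List.prod_append, List.prod_cons]
      by_cases hm : m ∈ l₂
      · have hc := comm_prod l₁ fun i hi => lt_of_le_of_ne
          (Nat.lt_succ_iff.1 (hlt i (List.mem_append_left _ hi)))
          (fun h => (List.disjoint_of_nodup_append hnd) (h ▸ hi) hm)
        rw [← mul_assoc, hc.eq, mul_assoc]
        exact isConj_iff.2 ⟨(g (m + 1))⁻¹, by group⟩
      · have hc := comm_prod l₂ fun i hi => lt_of_le_of_ne
          (Nat.lt_succ_iff.1 (hlt i (List.mem_append_right _ hi)))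
          (fun h => hm (h ▸ hi))
        rw [← hc.eq, mul_assoc]
    set g' := Function.update g m (g m * g (m + 1)) with hg'
    have map_eq : ∀ k : List ℕ, m ∉ k → k.map g' = k.map g := by
      intro k hk
      refine List.map_congr_left fun i hi => Function.update_of_ne ?_ _ _
      rintro rfl
      exact hk hi
    have merge : ((l₁ ++ l₂).map g).prod * g (m + 1) = ((l₁ ++ l₂).map g').prod := by
      obtain ⟨k₁, k₂, hk⟩ := List.append_of_mem (hl'.mem_iff.2 (List.self_mem_range_succ (n := m)))
      rw [hk] at hnd hlt ⊢
      have hnd' := List.nodup_cons.1 (List.perm_middle.nodup_iff.1 hnd)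
      have hm₁ : m ∉ k₁ := fun h => hnd'.1 (List.mem_append_left _ h)
      have hm₂ : m ∉ k₂ := fun h => hnd'.1 (List.mem_append_right _ h)
      have hc := comm_prod k₂ fun i hi => lt_of_le_of_ne
        (Nat.lt_succ_iff.1 (hlt i (by simp [hi]))) (fun h => hm₂ (h ▸ hi))
      simp only [List.map_append, List.map_cons, List.prod_append, List.prod_cons,
        map_eq k₁ hm₁, map_eq k₂ hm₂]
      simp only [hg', Function.update_self, mul_assoc, hc.eq]
    have comm' : ∀ i j, i + 2 ≤ j → j < m + 1 → Commute (g' i) (g' j) := by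
      intro i j hij hj
      have hi : g' i = g i := Function.update_of_ne (by omega) _ _
      rw [hi]
      by_cases hjm : j = m
      · subst hjm
        simp only [hg', Function.update_self]
        exact (hg i j hij (by omega)).mul_right (hg i (j + 1) (by omega) (by omega))
      · rw [hg', Function.update_of_ne hjm]
        exact hg i j hij (by omega)
    have range_eq : ((List.range (m + 1)).map g').prod = ((List.range (m + 1 + 1)).map g).prod := by
      rw [List.range_succ, List.range_succ (n := m + 1), List.range_succ]
      simp only [List.map_append, List.prod_append, map_eq _ List.not_mem_range_self,
        List.map_singleton, List.prod_singleton]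
      simp only [hg', Function.update_self, mul_assoc]
    rw [← range_eq]
    rw [merge] at to_end
    exact to_end.trans (ih g' _ comm' hl')

end Conjugacy

section Toggle

variable {α : Type*} [PartialOrder α]

theorem IsIdeal.insert_iff [DecidableEq α] {I : Finset α} (hI : IsIdeal I) (x : α) :
    IsIdeal (insert x I) ↔ ∀ y < x, y ∈ I := by
  refine ⟨fun h y hy => ?_, fun h z hz y hy => ?_⟩
  · exact Finset.mem_of_mem_insert_of_ne (h x (Finset.mem_insert_self _ _) y hy.le) hy.ne
  · rcases Finset.mem_insert.1 hz with rfl | hz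
    · rcases hy.eq_or_lt with rfl | hy
      · exact Finset.mem_insert_self _ _
      · exact Finset.mem_insert_of_mem (h y hy)
    · exact Finset.mem_insert_of_mem (hI z hz y hy)

theorem IsIdeal.erase_iff [DecidableEq α] {I : Finset α} (hI : IsIdeal I) (x : α) :
    IsIdeal (I.erase x) ↔ ∀ y, x < y → y ∉ I := by
  refine ⟨fun h y hy hyI => ?_, fun h z hz y hy => ?_⟩
  · exact Finset.notMem_erase x I (h y (Finset.mem_erase.2 ⟨hy.ne', hyI⟩) x hy.le)
  · obtain ⟨hzx, hzI⟩ := Finset.mem_erase.1 hz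
    refine Finset.mem_erase.2 ⟨?_, hI z hzI y hy⟩
    rintro rfl
    exact h z (lt_of_le_of_ne hy hzx.symm) hzI

theorem IsIdeal.toggle {I : Finset α} (hI : IsIdeal I) (x : α) : IsIdeal (toggle x I) := by
  unfold _root_.toggle
  split_ifs with h₁ h₂
  exacts [h₁.2, h₂.2, hI]

theorem toggle_toggle {I : Finset α} (hI : IsIdeal I) (x : α) : toggle x (toggle x I) = I := by
  classical
  by_cases hx : x ∈ I
  · by_cases h : IsIdeal (I.erase x)
    · have h₁ : toggle x I = I.erase x := by
        simp only [toggle, hx, not_true_eq_false, false_and, if_false, true_and]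
        convert if_pos h
      rw [h₁]
      simp only [toggle, Finset.notMem_erase, not_false_eq_true, true_and]
      rw [if_pos]
      · simp [Finset.insert_erase hx]
      · simpa [Finset.insert_erase hx] using hI
    · have h₁ : toggle x I = I := by
        simp only [toggle, hx, not_true_eq_false, false_and, if_false, true_and]
        convert if_neg h
      rw [h₁, h₁]
  · by_cases h : IsIdeal (insert x I)
    · have h₁ : toggle x I = insert x I := by
        simp only [toggle, hx, not_false_eq_true, true_and]
        convert if_pos h
      rw [h₁]
      simp only [toggle, Finset.mem_insert_self, not_true_eq_false, false_and, if_false, true_and]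
      rw [if_pos]
      · simp [Finset.erase_insert hx]
      · simpa [Finset.erase_insert hx] using hI
    · have h₁ : toggle x I = I := by
        simp only [toggle, hx, not_false_eq_true, true_and, false_and, if_false]
        convert if_neg h
      rw [h₁, h₁]

theorem mem_toggle_of_ne {x y : α} (h : y ≠ x) (I : Finset α) : y ∈ toggle x I ↔ y ∈ I := by
  unfold toggle
  split_ifs <;> simp [h]

theorem mem_toggle_self {I : Finset α} (hI : IsIdeal I) (x : α) :
    x ∈ toggle x I ↔ (x ∉ I ∧ ∀ y < x, y ∈ I) ∨ (x ∈ I ∧ ∃ y, x < y ∧ y ∈ I) := by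
  classical
  rw [← hI.insert_iff x, ← not_iff_not (a := x ∈ toggle x I)]
  have h := hI.erase_iff x
  unfold toggle
  by_cases hx : x ∈ I
  · by_cases h' : IsIdeal (I.erase x) <;> simp_all
  · by_cases h' : IsIdeal (insert x I) <;> simp_all

/-- Whether `x` belongs to `toggle x I` does not depend on an element `y ≠ x` of `I` that is not
adjacent to `x` in the Hasse diagram. -/
theorem mem_toggle_self_congr {I J : Finset α} (hI : IsIdeal I) (hJ : IsIdeal J) {x y : α}
    (hxy : x ≠ y) (h₁ : ¬ x ⋖ y) (h₂ : ¬ y ⋖ x) (h : ∀ z, z ≠ y → (z ∈ I ↔ z ∈ J)) :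
    x ∈ toggle x I ↔ x ∈ toggle x J := by
  have below : ∀ {I J : Finset α}, IsIdeal J → (∀ z, z ≠ y → (z ∈ I ↔ z ∈ J)) →
      (∀ z < x, z ∈ I) → ∀ z < x, z ∈ J := by
    intro I J hJ h hb z hz
    by_cases hzy : z = y
    · subst hzy
      obtain ⟨w, hzw, hwx⟩ := (not_covBy_iff hz).1 h₂
      exact hJ w ((h w hzw.ne').1 (hb w hwx)) z hzw.le
    · exact (h z hzy).1 (hb z hz)
  have above : ∀ {I J : Finset α}, IsIdeal I → (∀ z, z ≠ y → (z ∈ I ↔ z ∈ J)) →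
      (∃ z, x < z ∧ z ∈ I) → ∃ z, x < z ∧ z ∈ J := by
    rintro I J hI h ⟨z, hz, hzI⟩
    by_cases hzy : z = y
    · subst hzy
      obtain ⟨w, hxw, hwz⟩ := (not_covBy_iff hz).1 h₁
      exact ⟨w, hxw, (h w hwz.ne).1 (hI z hzI w hwz.le)⟩
    · exact ⟨z, hz, (h z hzy).1 hzI⟩
  have h' : ∀ z, z ≠ y → (z ∈ J ↔ z ∈ I) := fun z hz => (h z hz).symm
  rw [mem_toggle_self hI, mem_toggle_self hJ, h x hxy,
    iff_of_eq (propext ⟨below hJ h, below hI h'⟩), iff_of_eq (propext ⟨above hI h, above hJ h'⟩)]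

theorem toggle_comm {I : Finset α} (hI : IsIdeal I) {x y : α} (hxy : x ≠ y) (h₁ : ¬ x ⋖ y)
    (h₂ : ¬ y ⋖ x) : toggle x (toggle y I) = toggle y (toggle x I) := by
  ext z
  by_cases hzx : z = x
  · subst hzx
    rw [mem_toggle_of_ne hxy]
    exact mem_toggle_self_congr (hI.toggle y) hI hxy h₁ h₂ fun w hw => mem_toggle_of_ne hw I
  · rw [mem_toggle_of_ne hzx]
    by_cases hzy : z = y
    · subst hzy
      exact mem_toggle_self_congr hI (hI.toggle x) hxy.symm h₂ h₁ fun w hw =>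
        (mem_toggle_of_ne hw I).symm
    · rw [mem_toggle_of_ne hzy, mem_toggle_of_ne hzy, mem_toggle_of_ne hzx]

/-- The toggle at `x` as a permutation of the set of order ideals. -/
noncomputable def togglePerm (x : α) : Equiv.Perm {I : Finset α // IsIdeal I} :=
  Function.Involutive.toPerm (fun I => ⟨toggle x I, I.2.toggle x⟩)
    fun I => Subtype.ext (toggle_toggle I.2 x)

@[simp]
theorem coe_togglePerm (x : α) (I : {I : Finset α // IsIdeal I}) :
    (togglePerm x I : Finset α) = toggle x I :=
  rfl

theorem commute_togglePerm {x y : α} (hxy : x ≠ y) (h₁ : ¬ x ⋖ y) (h₂ : ¬ y ⋖ x) :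
    Commute (togglePerm x) (togglePerm y) :=
  Equiv.ext fun I => Subtype.ext (toggle_comm I.2 hxy h₁ h₂)

end Toggle

section Comotion

variable {a b : ℕ}

/-- The column toggle as a permutation of the set of order ideals. -/
noncomputable def colTogglePerm (i : Fin a) :
    Equiv.Perm {I : Finset (Fin a × Fin b) // IsIdeal I} :=
  ((List.ofFn fun j : Fin b => j).map fun j => togglePerm (i, j)).prod

theorem coe_colTogglePerm (i : Fin a) (I : {I : Finset (Fin a × Fin b) // IsIdeal I}) :
    (colTogglePerm i I : Finset (Fin a × Fin b)) = colToggle i I := by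
  unfold colTogglePerm colToggle
  induction List.ofFn fun j : Fin b => j with
  | nil => rfl
  | cons j l ih => simp [ih]

theorem commute_colTogglePerm {i i' : Fin a} (h : (i : ℕ) + 2 ≤ i') :
    Commute (colTogglePerm (b := b) i) (colTogglePerm i') := by
  refine Commute.list_prod_left _ _ fun x hx => Commute.list_prod_right _ _ fun y hy => ?_
  obtain ⟨j, -, rfl⟩ := List.mem_map.1 hx
  obtain ⟨j', -, rfl⟩ := List.mem_map.1 hy
  refine commute_togglePerm (fun h' => ?_) (fun h' => ?_) (fun h' => ?_)
  · rw [Prod.mk.injEq, Fin.ext_iff] at h'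
    omega
  · have hlt : (i : ℕ) + 1 < a := by omega
    have hj : j ≤ j' := h'.le.2
    refine h'.2 (c := (⟨i + 1, hlt⟩, j)) ?_ ?_
    · exact Prod.mk_lt_mk_iff_left.2 (Fin.lt_def.2 (Nat.lt_succ_self _))
    · exact Prod.mk_lt_mk_of_lt_of_le (Fin.lt_def.2 (by simp only; omega)) hj
  · have hle : i' ≤ i := h'.le.1
    rw [Fin.le_def] at hle
    omega

/-- Comotion as a permutation of the set of order ideals. -/
noncomputable def comotionPerm (ν : Equiv.Perm (Fin a)) :
    Equiv.Perm {I : Finset (Fin a × Fin b) // IsIdeal I} :=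
  ((List.ofFn fun t : Fin a => t).map fun t => colTogglePerm (ν t)).reverse.prod

theorem coe_comotionPerm (ν : Equiv.Perm (Fin a))
    (I : {I : Finset (Fin a × Fin b) // IsIdeal I}) :
    (comotionPerm ν I : Finset (Fin a × Fin b)) = comotion ν I := by
  unfold comotionPerm comotion
  induction List.ofFn fun t : Fin a => t generalizing I with
  | nil => rfl
  | cons t l ih => simp [ih, coe_colTogglePerm]

/-- Every comotion is conjugate to one fixed product of the column toggles. -/
theorem isConj_comotionPerm (ν : Equiv.Perm (Fin a)) :
    IsConj (comotionPerm (b := b) ν)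
      ((List.range a).map fun n => if h : n < a then colTogglePerm ⟨n, h⟩ else 1).prod := by
  have hperm : ((List.finRange a).map fun t => (ν t : ℕ)).reverse.Perm (List.range a) := by
    refine (List.reverse_perm _).trans ((List.perm_ext_iff_of_nodup ?_ List.nodup_range).2 ?_)
    · exact (List.nodup_finRange a).map (Fin.val_injective.comp ν.injective)
    · intro n
      simp only [List.mem_map, List.mem_finRange, true_and, List.mem_range]
      exact ⟨fun ⟨t, ht⟩ => ht ▸ (ν t).2, fun h => ⟨ν.symm ⟨n, h⟩, by simp⟩⟩
  have key := isConj_prod_map_range a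
    (fun n => if h : n < a then colTogglePerm (b := b) ⟨n, h⟩ else 1) _ ?_ hperm
  · rw [List.map_reverse, List.map_map, ← List.ofFn_id] at key
    have hmap : (List.ofFn fun t : Fin a => t).map (fun t => colTogglePerm (b := b) (ν t)) =
        (List.ofFn id).map ((fun n => if h : n < a then colTogglePerm (b := b) ⟨n, h⟩ else 1) ∘
          fun t => (ν t : ℕ)) :=
      List.map_congr_left fun t _ => by simp
    rwa [comotionPerm, hmap]
  · intro i j hij hj
    simp only [hj, show i < a by omega, dif_pos]
    exact commute_colTogglePerm hij

end Comotion

/-- for any two permutations `ν, ω` of `[a]`, the comotions `T_ν` and `T_ω`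
on `J(Q_{a,b})` have the same multiset of orbit sizes; this is expressed by the existence
of a bijection of the set of order ideals onto itself conjugating `T_ν` into `T_ω`. -/
theorem stmt_12 (a b : ℕ) (ha : 1 ≤ a) (hb : 1 ≤ b) (ν ω : Equiv.Perm (Fin a)) :
    ∃ φ : Finset (Fin a × Fin b) → Finset (Fin a × Fin b),
      Set.BijOn φ {I | IsIdeal I} {I | IsIdeal I} ∧
      ∀ I, IsIdeal I → φ (comotion ν I) = comotion ω (φ I) := by
  classical
  obtain ⟨c, hc⟩ := isConj_iff.1
    ((isConj_comotionPerm (b := b) ν).trans (isConj_comotionPerm ω).symm)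
  have hφ : ∀ I : {I : Finset (Fin a × Fin b) // IsIdeal I},
      (if h : IsIdeal I.1 then (c ⟨I.1, h⟩ : Finset (Fin a × Fin b)) else I.1) = c I :=
    fun I => dif_pos I.2
  refine ⟨fun I => if h : IsIdeal I then c ⟨I, h⟩ else I, ⟨fun I hI => ?_, ?_, ?_⟩, fun I hI => ?_⟩
  · exact Set.mem_of_eq_of_mem (hφ ⟨I, hI⟩) (c ⟨I, hI⟩).2
  · intro I hI J hJ h
    have h' := ((hφ ⟨I, hI⟩).symm.trans h).trans (hφ ⟨J, hJ⟩)
    exact congrArg Subtype.val (c.injective (Subtype.ext h'))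
  · intro J hJ
    refine ⟨c.symm ⟨J, hJ⟩, (c.symm ⟨J, hJ⟩).2, ?_⟩
    exact (hφ _).trans (congrArg Subtype.val (c.apply_symm_apply ⟨J, hJ⟩))
  · have h := coe_comotionPerm ν ⟨I, hI⟩
    have h₁ : c (comotionPerm ν ⟨I, hI⟩) = comotionPerm ω (c ⟨I, hI⟩) := by
      rw [← hc]
      simp
    dsimp only
    rw [← h, hφ, hφ ⟨I, hI⟩, h₁, coe_comotionPerm]
end
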